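/- Let H be a complex Hilbert space, V a balanced set of unit vectors separating points of H, K the norm-closed convex hull in B(H)_* of {ω_{ξ,η} : ξ, η ∈ V}, p a nonzero orthogonal projection on H, and λ ≥ 1. Suppose V_{p,λ} := (λpV) ∩ S₁(H) separates points of pH and that the map y ↦ pyp on B(H) is a contraction for the norm ‖·‖_K. Then for every normal functional ψ on B(pH) (viewed as a normal functional on B(H) supported on pH), q_{K_{p,λ}}(ψ) ≥ (1/λ²) · q_K(ψ), with the convention that both sides may be ∞. -/

import Mathlib

noncomputable section

open scoped InnerProductSpace ENNReal Pointwise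

/-- The vector functional `ω_{ξ,η}` on `B(H)` given by `x ↦ ⟨xξ, η⟩`
(linear in `x`; in Mathlib's convention this is `⟪η, x ξ⟫_ℂ`). -/
def omegaFunctional {H : Type*} [NormedAddCommGroup H] [InnerProductSpace ℂ H]
    (ξ η : H) : (H →L[ℂ] H) →L[ℂ] ℂ :=
  (innerSL ℂ η).comp (ContinuousLinearMap.apply ℂ H ξ)

/-- A continuous linear functional on `B(H)` is *normal* if it lies in the norm closure of the
linear span of the vector functionals (this is the predual `B(H)_*`, i.e. the trace-class
induced functionals). -/
def IsNormalFunctional {H : Type*} [NormedAddCommGroup H] [InnerProductSpace ℂ H]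
    (ψ : (H →L[ℂ] H) →L[ℂ] ℂ) : Prop :=
  ψ ∈ closure (Submodule.span ℂ {φ : (H →L[ℂ] H) →L[ℂ] ℂ | ∃ ξ η : H, φ = omegaFunctional ξ η} :
    Set ((H →L[ℂ] H) →L[ℂ] ℂ))

/-- A *normal state* on `B(H)`: a positive normal functional of norm one. -/
def IsNormalState {H : Type*} [NormedAddCommGroup H] [InnerProductSpace ℂ H] [CompleteSpace H]
    (φ : (H →L[ℂ] H) →L[ℂ] ℂ) : Prop :=
  IsNormalFunctional φ ∧ ‖φ‖ = 1 ∧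
    ∀ x : H →L[ℂ] H, x.IsPositive → 0 ≤ (φ x).re ∧ (φ x).im = 0

/-- `‖x‖_K := sup {|ψ(x)| : ψ ∈ K}`. -/
def normK {H : Type*} [NormedAddCommGroup H] [InnerProductSpace ℂ H]
    (K : Set ((H →L[ℂ] H) →L[ℂ] ℂ)) (x : H →L[ℂ] H) : ℝ :=
  sSup ((fun ψ : (H →L[ℂ] H) →L[ℂ] ℂ => ‖ψ x‖) '' K)

/-- The Minkowski functional `q_K(ψ) := inf {α ≥ 0 : ψ ∈ αK}`, with value `∞` if no
such `α` exists. -/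
def qK {H : Type*} [NormedAddCommGroup H] [InnerProductSpace ℂ H]
    (K : Set ((H →L[ℂ] H) →L[ℂ] ℂ)) (ψ : (H →L[ℂ] H) →L[ℂ] ℂ) : ℝ≥0∞ :=
  sInf {c : ℝ≥0∞ | ∃ r : ℝ, 0 ≤ r ∧ c = ENNReal.ofReal r ∧ ψ ∈ r • K}

section VectorFunctionals

variable {H : Type*} [NormedAddCommGroup H] [InnerProductSpace ℂ H]

@[simp]
lemma omegaFunctional_apply (ξ η : H) (x : H →L[ℂ] H) :
    omegaFunctional ξ η x = ⟪η, x ξ⟫_ℂ := rfl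

lemma norm_omegaFunctional_le (ξ η : H) : ‖omegaFunctional ξ η‖ ≤ ‖ξ‖ * ‖η‖ := by
  refine ContinuousLinearMap.opNorm_le_bound _ (by positivity) fun x => ?_
  calc ‖⟪η, x ξ⟫_ℂ‖ ≤ ‖η‖ * ‖x ξ‖ := norm_inner_le_norm _ _
    _ ≤ ‖η‖ * (‖x‖ * ‖ξ‖) := by gcongr; exact x.le_opNorm ξ
    _ = ‖ξ‖ * ‖η‖ * ‖x‖ := by ring

/-- Every bounded functional on `B(H)_*` is evaluation at an operator: here, for the restriction
to the normal functionals of a bounded functional on the dual of `B(H)`. -/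
lemma exists_eval_of_normal [CompleteSpace H] (F : ((H →L[ℂ] H) →L[ℂ] ℂ) →L[ℂ] ℂ) :
    ∃ y : H →L[ℂ] H, ∀ ψ, IsNormalFunctional ψ → F ψ = ψ y := by
  let B : H →ₗ⋆[ℂ] H →ₗ[ℂ] ℂ := LinearMap.mk₂'ₛₗ (starRingEnd ℂ) (RingHom.id ℂ)
    (fun η ξ => F (omegaFunctional ξ η))
    (fun η η' ξ => by
      rw [← map_add]; congr 1; ext x; simp)
    (fun c η ξ => by
      rw [← map_smul]; congr 1; ext x; simp [mul_comm])
    (fun η ξ ξ' => by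
      rw [← map_add]; congr 1; ext x; simp)
    (fun c η ξ => by
      rw [RingHom.id_apply, ← map_smul]; congr 1; ext x; simp)
  let B' : H →L⋆[ℂ] H →L[ℂ] ℂ := B.mkContinuous₂ ‖F‖ fun η ξ => by
    calc ‖F (omegaFunctional ξ η)‖ ≤ ‖F‖ * ‖omegaFunctional ξ η‖ := F.le_opNorm _
      _ ≤ ‖F‖ * (‖ξ‖ * ‖η‖) := by gcongr; exact norm_omegaFunctional_le ξ η
      _ = ‖F‖ * ‖η‖ * ‖ξ‖ := by ring
  refine ⟨ContinuousLinearMap.adjoint (InnerProductSpace.continuousLinearMapOfBilin B'),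
    fun ψ hψ => ?_⟩
  set y := ContinuousLinearMap.adjoint (InnerProductSpace.continuousLinearMapOfBilin B')
  refine closure_minimal (t := {φ | F φ = φ y}) (fun φ hφ => ?_)
    (isClosed_eq F.continuous (ContinuousLinearMap.apply ℂ ℂ y).continuous) hψ
  have hle : Submodule.span ℂ
      {φ : (H →L[ℂ] H) →L[ℂ] ℂ | ∃ ξ η : H, φ = omegaFunctional ξ η} ≤
      LinearMap.eqLocus (F : ((H →L[ℂ] H) →L[ℂ] ℂ) →ₗ[ℂ] ℂ)
        (ContinuousLinearMap.apply ℂ ℂ y : ((H →L[ℂ] H) →L[ℂ] ℂ) →ₗ[ℂ] ℂ) := by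
    refine Submodule.span_le.2 ?_
    rintro _ ⟨ξ, η, rfl⟩
    change F (omegaFunctional ξ η) = ⟪η, y ξ⟫_ℂ
    rw [ContinuousLinearMap.adjoint_inner_right,
      InnerProductSpace.continuousLinearMapOfBilin_apply]
    rfl
  exact hle hφ

/-- The norm-closed convex hull of the vector functionals `ω_{ξ,η}` with `ξ, η ∈ V`. -/
def vectorHull (V : Set H) : Set ((H →L[ℂ] H) →L[ℂ] ℂ) :=
  closure (convexHull ℝ
    {φ : (H →L[ℂ] H) →L[ℂ] ℂ | ∃ ξ ∈ V, ∃ η ∈ V, φ = omegaFunctional ξ η})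

lemma omegaFunctional_mem_vectorHull {V : Set H} {ξ η : H} (hξ : ξ ∈ V) (hη : η ∈ V) :
    omegaFunctional ξ η ∈ vectorHull V :=
  subset_closure (subset_convexHull ℝ _ ⟨ξ, hξ, η, hη, rfl⟩)

lemma vectorHull_nonempty {V : Set H} (h : V.Nonempty) : (vectorHull V).Nonempty :=
  let ⟨_, hξ⟩ := h
  ⟨_, omegaFunctional_mem_vectorHull hξ hξ⟩

lemma nonempty_of_mem_vectorHull {V : Set H} {φ : (H →L[ℂ] H) →L[ℂ] ℂ}
    (hφ : φ ∈ vectorHull V) : V.Nonempty := by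
  obtain ⟨_, ξ, hξ, -⟩ := convexHull_nonempty_iff.1 (closure_nonempty_iff.1 ⟨φ, hφ⟩)
  exact ⟨ξ, hξ⟩

lemma isNormalFunctional_of_mem_vectorHull {V : Set H} {φ : (H →L[ℂ] H) →L[ℂ] ℂ}
    (hφ : φ ∈ vectorHull V) : IsNormalFunctional φ := by
  refine closure_mono (convexHull_min ?_ ?_) hφ
  · rintro _ ⟨ξ, -, η, -, rfl⟩
    exact Submodule.subset_span ⟨ξ, η, rfl⟩
  · exact ((Submodule.span ℂ
      {φ : (H →L[ℂ] H) →L[ℂ] ℂ | ∃ ξ η : H, φ = omegaFunctional ξ η}).restrictScalars ℝ).convex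

lemma norm_apply_le_of_mem_vectorHull {V : Set H} {y : H →L[ℂ] H} {C : ℝ}
    (h : ∀ ξ ∈ V, ∀ η ∈ V, ‖⟪η, y ξ⟫_ℂ‖ ≤ C) {φ : (H →L[ℂ] H) →L[ℂ] ℂ}
    (hφ : φ ∈ vectorHull V) : ‖φ y‖ ≤ C := by
  refine closure_minimal (t := {φ | ‖φ y‖ ≤ C}) (convexHull_min ?_ ?_)
    (isClosed_le (ContinuousLinearMap.apply ℂ ℂ y).continuous.norm continuous_const) hφ
  · rintro _ ⟨ξ, hξ, η, hη, rfl⟩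
    exact h ξ hξ η hη
  · intro a ha b hb s t hs ht hst
    have ha' : ‖a y‖ ≤ C := ha
    have hb' : ‖b y‖ ≤ C := hb
    calc ‖(s • a + t • b) y‖ = ‖s • a y + t • b y‖ := rfl
      _ ≤ s * ‖a y‖ + t * ‖b y‖ := by
        refine (norm_add_le _ _).trans_eq ?_
        rw [norm_smul, norm_smul, Real.norm_of_nonneg hs, Real.norm_of_nonneg ht]
      _ ≤ s * C + t * C := by gcongr
      _ = C := by rw [← add_mul, hst, one_mul]

lemma norm_inner_le_normK {V : Set H} (hunit : ∀ ξ ∈ V, ‖ξ‖ = 1) (y : H →L[ℂ] H) {ξ η : H}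
    (hξ : ξ ∈ V) (hη : η ∈ V) : ‖⟪η, y ξ⟫_ℂ‖ ≤ normK (vectorHull V) y := by
  refine le_csSup ⟨‖y‖, ?_⟩ ⟨_, omegaFunctional_mem_vectorHull hξ hη, rfl⟩
  rintro _ ⟨φ, hφ, rfl⟩
  refine norm_apply_le_of_mem_vectorHull (fun ξ hξ η hη => ?_) hφ
  calc ‖⟪η, y ξ⟫_ℂ‖ ≤ ‖η‖ * ‖y ξ‖ := norm_inner_le_norm _ _
    _ ≤ ‖η‖ * (‖y‖ * ‖ξ‖) := by gcongr; exact y.le_opNorm ξ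
    _ = ‖y‖ := by rw [hunit ξ hξ, hunit η hη]; ring

/-- The bipolar theorem for the hull of the vector functionals of a balanced set `V`, in the
duality of `B(H)_*` and `B(H)`. -/
lemma mem_vectorHull_of_norm_le_normK [CompleteSpace H] {V : Set H} (hne : V.Nonempty)
    (hbal : ∀ ξ ∈ V, ∀ c : ℂ, ‖c‖ = 1 → c • ξ ∈ V) {φ : (H →L[ℂ] H) →L[ℂ] ℂ}
    (hφ : IsNormalFunctional φ) (hle : ∀ y, ‖φ y‖ ≤ normK (vectorHull V) y) :
    φ ∈ vectorHull V := by
  by_contra hmem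
  obtain ⟨F, u, hF, hu⟩ := RCLike.geometric_hahn_banach_closed_point (𝕜 := ℂ)
    (convex_convexHull ℝ _).closure isClosed_closure hmem
  obtain ⟨y, hy⟩ := exists_eval_of_normal F
  have hyu : normK (vectorHull V) y ≤ u := by
    refine csSup_le ((vectorHull_nonempty hne).image _) ?_
    rintro _ ⟨a, ha, rfl⟩
    refine norm_apply_le_of_mem_vectorHull (fun ξ hξ η hη => ?_) ha
    obtain ⟨c, hc, hcz⟩ := RCLike.exists_norm_mul_eq_self (⟪η, y ξ⟫_ℂ)
    have hc0 : c ≠ 0 := norm_ne_zero_iff.1 (by rw [hc]; exact one_ne_zero)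
    have hm := omegaFunctional_mem_vectorHull (hbal ξ hξ c⁻¹ (by rw [norm_inv, hc, inv_one])) hη
    have hlt := hF _ hm
    rw [hy _ (isNormalFunctional_of_mem_vectorHull hm), omegaFunctional_apply, map_smul,
      inner_smul_right, ← hcz, inv_mul_cancel_left₀ hc0] at hlt
    simpa using hlt.le
  rw [hy φ hφ] at hu
  exact absurd (hu.trans_le ((RCLike.re_le_norm _).trans (hle y))) hyu.not_gt

lemma IsNormalFunctional.smul {φ : (H →L[ℂ] H) →L[ℂ] ℂ} (hφ : IsNormalFunctional φ) (r : ℝ) :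
    IsNormalFunctional (r • φ) :=
  ((Submodule.span ℂ
    {φ : (H →L[ℂ] H) →L[ℂ] ℂ | ∃ ξ η : H, φ = omegaFunctional ξ η}).restrictScalars
      ℝ).topologicalClosure.smul_mem r hφ

end VectorFunctionals

/-- With `p`, `l`, `V_{p,l}`, `K_{p,l}` as before, assume `V_{p,l}` separates
points of `pH` and that `y ↦ pyp` is a `‖·‖_K`-contraction. Then every normal functional `ψ`
on `B(pH)` (viewed on `B(H)` via `ψ(x) = ψ(pxp)`) satisfies
`q_{K_{p,l}}(ψ) ≥ (1/l²) · q_K(ψ)` (in `ℝ≥0∞`, both sides possibly infinite). -/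
theorem stmt5 {H : Type*} [NormedAddCommGroup H] [InnerProductSpace ℂ H] [CompleteSpace H]
    (V : Set H)
    (hunit : ∀ ξ ∈ V, ‖ξ‖ = 1)
    (hbal : ∀ ξ ∈ V, ∀ c : ℂ, ‖c‖ = 1 → c • ξ ∈ V)
    (hsep : ∀ ξ : H, (∀ η ∈ V, ⟪ξ, η⟫_ℂ = 0) → ξ = 0)
    (K : Set ((H →L[ℂ] H) →L[ℂ] ℂ))
    (hK : K = closure (convexHull ℝ
      {φ : (H →L[ℂ] H) →L[ℂ] ℂ | ∃ ξ ∈ V, ∃ η ∈ V, φ = omegaFunctional ξ η}))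
    (p : H →L[ℂ] H) (hp_idem : IsIdempotentElem p) (hp_sa : IsSelfAdjoint p) (hp_ne : p ≠ 0)
    (l : ℝ) (hl : 1 ≤ l)
    (Vp : Set H) (hVp : Vp = {ζ : H | (∃ ξ ∈ V, ζ = l • p ξ) ∧ ‖ζ‖ = 1})
    (Kp : Set ((H →L[ℂ] H) →L[ℂ] ℂ))
    (hKp : Kp = closure (convexHull ℝ
      {φ : (H →L[ℂ] H) →L[ℂ] ℂ | ∃ ξ ∈ Vp, ∃ η ∈ Vp, φ = omegaFunctional ξ η}))
    (hVpsep : ∀ ξ : H, p ξ = ξ → (∀ η ∈ Vp, ⟪ξ, η⟫_ℂ = 0) → ξ = 0)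
    (hcontr : ∀ y : H →L[ℂ] H, normK K (p ∘L y ∘L p) ≤ normK K y)
    (ψ : (H →L[ℂ] H) →L[ℂ] ℂ) (hψ : IsNormalFunctional ψ)
    (hψp : ∀ x : H →L[ℂ] H, ψ x = ψ (p ∘L x ∘L p)) :
    ENNReal.ofReal (1 / l ^ 2) * qK K ψ ≤ qK Kp ψ := by
  have hl0 : 0 < l := one_pos.trans_le hl
  change K = vectorHull V at hK
  change Kp = vectorHull Vp at hKp
  refine le_sInf ?_
  rintro _ ⟨r, hr, rfl, φ, hφ, rfl⟩
  rw [hKp] at hφ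
  have hV : V.Nonempty := by
    obtain ⟨ζ, hζ⟩ := nonempty_of_mem_vectorHull hφ
    rw [hVp] at hζ
    obtain ⟨⟨ξ, hξ, -⟩, -⟩ := hζ
    exact ⟨ξ, hξ⟩
  have hbound : ∀ y, ‖φ y‖ ≤ l ^ 2 * normK K y := by
    refine fun y => norm_apply_le_of_mem_vectorHull (fun ζ hζ ζ' hζ' => ?_) hφ
    rw [hVp] at hζ hζ'
    obtain ⟨⟨ξ, hξ, rfl⟩, -⟩ := hζ
    obtain ⟨⟨η, hη, rfl⟩, -⟩ := hζ'
    have hpp : ⟪p η, y (p ξ)⟫_ℂ = ⟪η, (p ∘L y ∘L p) ξ⟫_ℂ :=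
      (ContinuousLinearMap.isSelfAdjoint_iff_isSymmetric.1 hp_sa) η (y (p ξ))
    have hscale : ‖⟪l • p η, y (l • p ξ)⟫_ℂ‖ = l ^ 2 * ‖⟪p η, y (p ξ)⟫_ℂ‖ := by
      rw [← Complex.coe_smul, ← Complex.coe_smul, map_smul, inner_smul_left, inner_smul_right,
        norm_mul, norm_mul, RCLike.norm_conj, Complex.norm_real, Real.norm_of_nonneg hl0.le]
      ring
    rw [hscale, hpp]
    gcongr
    refine le_trans ?_ (hcontr y)
    rw [hK]
    exact norm_inner_le_normK hunit _ hξ hη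
  have hmem : (l ^ 2)⁻¹ • φ ∈ K := by
    rw [hK] at hbound ⊢
    refine mem_vectorHull_of_norm_le_normK hV hbal
      ((isNormalFunctional_of_mem_vectorHull hφ).smul _) fun y => ?_
    rw [smul_apply, norm_smul, Real.norm_of_nonneg (by positivity),
      inv_mul_le_iff₀ (by positivity)]
    exact hbound y
  have hq : qK K (r • φ) ≤ ENNReal.ofReal (r * l ^ 2) := by
    refine sInf_le ⟨r * l ^ 2, by positivity, rfl, _, hmem, ?_⟩
    change (r * l ^ 2) • (l ^ 2)⁻¹ • φ = r • φ
    rw [smul_smul, mul_assoc, mul_inv_cancel₀ (by positivity), mul_one]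
  calc ENNReal.ofReal (1 / l ^ 2) * qK K (r • φ)
      ≤ ENNReal.ofReal (1 / l ^ 2) * ENNReal.ofReal (r * l ^ 2) := by gcongr
    _ = ENNReal.ofReal r := by
      rw [← ENNReal.ofReal_mul (by positivity)]
      congr 1
      field_simp
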